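/- For every finite connected simple graph G on n vertices and every integer k ≥ 1, there exists a partition {V_1, …, V_s} of the vertex set V with diameter-bound k such that each induced subgraph G[V_i] is connected and k·(s − 1) ≤ 2n (equivalently, s ≤ 2n/k + 1). -/

import Mathlib

/-- `G` restricted to `S` has diameter at most `k`: every pair of vertices of the
induced subgraph is at extended distance at most `k`. -/
def DiamLE {V : Type*} (G : SimpleGraph V) (S : Set V) (k : ℕ) : Prop :=
  ∀ u v : S, (G.induce S).edist u v ≤ (k : ℕ∞)

/-- If iterating `p` from any vertex of `T` stays in `T` and walks along edges until it hits `u`,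
then a vertex reaching `u` after `i` iterations is at distance at most `i` from `u` in `T`. -/
lemma induce_edist_le_of_iterate_eq {V : Type*} {G : SimpleGraph V} {p : V → V} {T : Set V} {u : V}
    (hu : u ∈ T) (hT : ∀ w ∈ T, w ≠ u → p w ∈ T ∧ G.Adj w (p w)) :
    ∀ (i : ℕ) (w : V) (hw : w ∈ T), p^[i] w = u →
      (G.induce T).edist ⟨w, hw⟩ ⟨u, hu⟩ ≤ (i : ℕ∞) := by
  intro i
  induction i with
  | zero =>
    rintro w hw rfl
    simp
  | succ i ih =>
    intro w hw h
    by_cases hwu : w = u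
    · subst hwu
      simp
    · obtain ⟨hpT, hadj⟩ := hT w hw hwu
      have h₁ : (G.induce T).edist ⟨w, hw⟩ ⟨p w, hpT⟩ ≤ 1 :=
        (SimpleGraph.edist_eq_one_iff_adj.2 (by simpa using hadj)).le
      calc _ ≤ _ := SimpleGraph.edist_triangle (v := ⟨p w, hpT⟩)
        _ ≤ 1 + (i : ℕ∞) := add_le_add h₁ (ih _ hpT h)
        _ = _ := by push_cast; exact add_comm _ _

lemma diamLE_of_iterate_eq {V : Type*} {G : SimpleGraph V} {p : V → V} {T : Set V} {u : V}
    {r k : ℕ} (hrk : 2 * r ≤ k) (hu : u ∈ T)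
    (hT : ∀ w ∈ T, w ≠ u → p w ∈ T ∧ G.Adj w (p w)) (h : ∀ w ∈ T, ∃ i ≤ r, p^[i] w = u) :
    DiamLE G T k := by
  have key : ∀ w : T, (G.induce T).edist w ⟨u, hu⟩ ≤ (r : ℕ∞) := by
    rintro ⟨w, hw⟩
    obtain ⟨i, hi, hiu⟩ := h w hw
    exact (induce_edist_le_of_iterate_eq hu hT i w hw hiu).trans (by exact_mod_cast hi)
  intro a b
  calc _ ≤ _ := SimpleGraph.edist_triangle (v := ⟨u, hu⟩)
    _ ≤ (r : ℕ∞) + r := add_le_add (key a) (by rw [SimpleGraph.edist_comm]; exact key b)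
    _ ≤ _ := by rw [← two_mul]; exact_mod_cast hrk

lemma DiamLE.connected {V : Type*} {G : SimpleGraph V} {S : Set V} {k : ℕ} (h : DiamLE G S k)
    (hS : S.Nonempty) : (G.induce S).Connected := by
  have := hS.to_subtype
  refine ⟨fun a b => ?_⟩
  exact SimpleGraph.edist_ne_top_iff_reachable.1 ((h a b).trans_lt (ENat.natCast_lt_top k)).ne

lemma apply_iterate_eq_sub {V : Type*} {p : V → V} {d : V → ℕ} (hd : ∀ v, d (p v) = d v - 1)
    (i : ℕ) (v : V) : d (p^[i] v) = d v - i := by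
  induction i with
  | zero => rfl
  | succ i ih => rw [Function.iterate_succ_apply', hd, ih]; omega

/-- A parent function towards `ρ` in a connected graph. -/
lemma SimpleGraph.Connected.exists_parent {V : Type*} {G : SimpleGraph V} (hG : G.Connected)
    (ρ : V) :
    ∃ p : V → V, (∀ v, G.dist ρ (p v) = G.dist ρ v - 1) ∧ ∀ v, v ≠ ρ → G.Adj v (p v) := by
  have : ∀ v, ∃ w, G.dist ρ w = G.dist ρ v - 1 ∧ (v ≠ ρ → G.Adj v w) := by
    intro v
    by_cases hv : v = ρ
    · subst hv
      exact ⟨v, by simp⟩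
    · obtain ⟨q, hq⟩ := hG.exists_walk_length_eq_dist v ρ
      cases q with
      | nil => exact absurd rfl hv
      | @cons _ w _ hadj q =>
        refine ⟨w, ?_, fun _ => hadj⟩
        rw [SimpleGraph.Walk.length_cons] at hq
        have h₁ := SimpleGraph.dist_le q
        have h₂ := hG.dist_triangle (u := v) (v := w) (w := ρ)
        have h₃ := SimpleGraph.dist_eq_one_iff_adj.2 hadj
        rw [SimpleGraph.dist_comm (u := ρ), SimpleGraph.dist_comm (u := ρ)]
        omega
  choose p hp using this
  exact ⟨p, fun v => (hp v).1, fun v => (hp v).2⟩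

/-- Greedily cutting off subtrees of height `r` partitions any parent-closed set. -/
lemma exists_partition_of_parent {V : Type*} {G : SimpleGraph V} {p : V → V} {d : V → ℕ} {ρ : V}
    {r k : ℕ} (hrk : 2 * r ≤ k) (hd : ∀ v, d (p v) = d v - 1) (hρ : ∀ v, d v = 0 ↔ v = ρ)
    (hp : ∀ v, v ≠ ρ → G.Adj v (p v)) (S : Finset V) (hρS : ρ ∈ S) (hS : ∀ v ∈ S, p v ∈ S) :
    ∃ (m : ℕ) (P : Fin (m + 1) → Set V),
      (∀ i, (P i).Nonempty) ∧ (Pairwise fun i j => Disjoint (P i) (P j)) ∧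
      (⋃ i, P i) = S ∧ (∀ i, DiamLE G (P i) k) ∧ m * (r + 1) ≤ S.card := by
  classical
  induction S using Finset.strongInduction with
  | H S ih =>
  obtain ⟨v, hvS, hv⟩ := S.exists_max_image d ⟨ρ, hρS⟩
  by_cases hvr : d v ≤ r
  · refine ⟨0, fun _ => S, fun _ => ⟨ρ, hρS⟩, fun i j hij => absurd (by omega) hij,
      Set.iUnion_const _, fun _ => ?_, by simp⟩
    refine diamLE_of_iterate_eq hrk (p := p) hρS (fun w hw hne => ⟨hS w hw, hp w hne⟩) ?_
    exact fun w hw => ⟨d w, (hv w hw).trans hvr, by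
      rw [← hρ, apply_iterate_eq_sub hd, Nat.sub_self]⟩
  · have hSi : ∀ i, ∀ w ∈ S, p^[i] w ∈ S := fun i w hw =>
      Set.MapsTo.iterate (s := (S : Set V)) hS i hw
    set u := p^[r] v with hu
    have hdu : d u = d v - r := apply_iterate_eq_sub hd r v
    set T := S.filter (fun w => ∃ i, p^[i] w = u) with hT
    have huT : u ∈ T := Finset.mem_filter.2 ⟨hSi r v hvS, 0, rfl⟩
    have hρT : ρ ∉ T := by
      intro h
      obtain ⟨i, hi⟩ := (Finset.mem_filter.1 h).2
      have := apply_iterate_eq_sub hd i ρ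
      rw [hi, (hρ ρ).2 rfl] at this
      omega
    have hTS : T ⊆ S := Finset.filter_subset _ _
    have hcard : r + 1 ≤ T.card := by
      have hinj : Set.InjOn (fun j => p^[j] v) (Finset.range (r + 1)) := by
        intro a ha b hb hab
        have := congrArg d hab
        simp only [apply_iterate_eq_sub hd] at this
        simp only [Finset.coe_range, Set.mem_Iio] at ha hb
        omega
      rw [← Finset.card_range (r + 1), ← Finset.card_image_of_injOn hinj]
      refine Finset.card_le_card fun w hw => ?_
      obtain ⟨j, hj, rfl⟩ := Finset.mem_image.1 hw
      rw [Finset.mem_range] at hj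
      refine Finset.mem_filter.2 ⟨hSi j v hvS, r - j, ?_⟩
      rw [← Function.iterate_add_apply, Nat.sub_add_cancel (by omega)]
    have hdiam : DiamLE G (T : Set V) k := by
      refine diamLE_of_iterate_eq hrk (p := p) huT (fun w hw hne => ?_) (fun w hw => ?_)
      · obtain ⟨hwS, i, hi⟩ := Finset.mem_filter.1 hw
        refine ⟨Finset.mem_filter.2 ⟨hS w hwS, ?_⟩, hp w (ne_of_mem_of_not_mem hw hρT)⟩
        cases i with
        | zero => exact absurd hi hne
        | succ i => exact ⟨i, hi⟩
      · obtain ⟨hwS, i, hi⟩ := Finset.mem_filter.1 hw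
        refine ⟨i, ?_, hi⟩
        have := apply_iterate_eq_sub hd i w
        have := hv w hwS
        rw [hi] at *
        omega
    obtain ⟨m, P, hne, hdisj, hU, hD, hm⟩ := ih (S \ T) (Finset.sdiff_ssubset hTS ⟨u, huT⟩)
      (Finset.mem_sdiff.2 ⟨hρS, hρT⟩) (by
        intro w hw
        obtain ⟨hwS, hwT⟩ := Finset.mem_sdiff.1 hw
        refine Finset.mem_sdiff.2 ⟨hS w hwS, fun h => hwT ?_⟩
        obtain ⟨i, hi⟩ := (Finset.mem_filter.1 h).2
        exact Finset.mem_filter.2 ⟨hwS, i + 1, hi⟩)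
    have hTP : ∀ i, Disjoint (T : Set V) (P i) := fun i =>
      Set.disjoint_left.2 fun w hw hwP => by
        have : w ∈ ((S \ T : Finset V) : Set V) := hU ▸ Set.mem_iUnion_of_mem i hwP
        exact (Finset.mem_sdiff.1 this).2 hw
    refine ⟨m + 1, Fin.cons (T : Set V) P, ?_, ?_, ?_, ?_, ?_⟩
    · exact Fin.cases ⟨u, huT⟩ hne
    · intro i j hij
      induction i using Fin.cases with
      | zero =>
        induction j using Fin.cases with
        | zero => exact absurd rfl hij
        | succ j => exact hTP j
      | succ i =>
        induction j using Fin.cases with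
        | zero => exact (hTP i).symm
        | succ j => exact hdisj fun h => hij (congrArg Fin.succ h)
    · have : (⋃ i, (Fin.cons (T : Set V) P : Fin (m + 1 + 1) → Set V) i) =
          (T : Set V) ∪ ⋃ i, P i := by
        ext w
        simp only [Set.mem_iUnion, Fin.exists_fin_succ, Fin.cons_zero, Fin.cons_succ, Set.mem_union]
      rw [this, hU, ← Finset.coe_union, Finset.union_sdiff_of_subset hTS]
    · exact Fin.cases hdiam hD
    · rw [Finset.card_sdiff_of_subset hTS] at hm
      have := Finset.card_le_card hTS
      rw [add_mul]
      omega

/-- every finite connected simple graph on `n` vertices admits, for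
each integer `k ≥ 1`, a partition with diameter-bound `k` into connected parts
whose number of parts `s` satisfies `k * (s - 1) ≤ 2 * n`. -/
theorem connected_k_grouping_size_bound
    {V : Type*} [Fintype V] (G : SimpleGraph V) (hG : G.Connected)
    (k : ℕ) (hk : 1 ≤ k) :
    ∃ (s : ℕ) (P : Fin s → Set V),
      (∀ i, (P i).Nonempty) ∧
      (Pairwise fun i j => Disjoint (P i) (P j)) ∧
      (⋃ i, P i) = Set.univ ∧
      (∀ i, (G.induce (P i)).Connected) ∧
      (∀ i, DiamLE G (P i) k) ∧
      k * (s - 1) ≤ 2 * Fintype.card V := by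
  obtain ⟨ρ⟩ := hG.nonempty
  obtain ⟨p, hd, hp⟩ := hG.exists_parent ρ
  obtain ⟨m, P, hne, hdisj, hU, hD, hm⟩ := exists_partition_of_parent (r := k / 2) (k := k)
    (Nat.mul_div_le k 2) hd (fun v => by rw [hG.dist_eq_zero_iff, eq_comm]) hp Finset.univ
    (Finset.mem_univ ρ) (fun _ _ => Finset.mem_univ _)
  refine ⟨m + 1, P, hne, hdisj, by simpa using hU, fun i => (hD i).connected (hne i), hD, ?_⟩
  rw [Finset.card_univ] at hm
  calc k * (m + 1 - 1) ≤ (2 * (k / 2 + 1)) * m := Nat.mul_le_mul_right _ (by omega)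
    _ = 2 * (m * (k / 2 + 1)) := by ring
    _ ≤ _ := Nat.mul_le_mul_left _ hm
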